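/- Let f : ℝ → ℝ be a nonlinearity of the form f(u) = u·f₀(u²) satisfying assumptions (A1)–(A5). There exists a constant C > 0, depending only on f, with the following property: for every smooth global solution u : ℝ × ℝ³ → ℝ of the semilinear wave equation ∂ₜ²u − Δu + f(u) = 0 with smooth compactly supported initial data and with u(t,·) compactly supported for each t, and for every t ≥ 0, one has E₂(t) ≤ E₂(0)·exp( C ∫₀ᵗ (∫_{ℝ³} |u(τ,z)|¹² dz)^{1/3} dτ ), where E₂(t)² = ½∫_{ℝ³}(|∇_z u(t,z)|² + (∂ₜu)(t,z)²) dz + ½ Σ_{j=1}^{3} ∫_{ℝ³}(|∇_z ∂_{z_j}u(t,z)|² + (∂_{z_j}∂ₜu)(t,z)²) dz. -/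

import Mathlib

open MeasureTheory Filter Real Metric

noncomputable section

/-- Euclidean 3-space. -/
abbrev R3 : Type := EuclideanSpace ℝ (Fin 3)

/-- Time derivative ∂ₜu. -/
def dt (u : ℝ → R3 → ℝ) (t : ℝ) (z : R3) : ℝ := deriv (fun τ => u τ z) t

/-- Second time derivative ∂ₜ²u. -/
def dt2 (u : ℝ → R3 → ℝ) (t : ℝ) (z : R3) : ℝ := deriv (fun τ => dt u τ z) t

/-- Spatial Laplacian: the sum of the three second partial derivatives. -/
def lap (w : R3 → ℝ) (z : R3) : ℝ :=
  ∑ i : Fin 3, fderiv ℝ (fun y => fderiv ℝ w y (EuclideanSpace.single i 1)) z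
      (EuclideanSpace.single i 1)

/-- A function on ℝ³ is radial if its value depends only on the norm. -/
def Radial (g : R3 → ℝ) : Prop := ∀ z w : R3, ‖z‖ = ‖w‖ → g z = g w

/-- Assumptions (A1)–(A5) on the nonlinearity: f(u) = u·f₀(u²) with f₀ smooth,
f₀ ≥ 0 on [0,∞), u·f'(u) ∼ f(u), c₁|u|⁵ ≤ |f(u)| ≤ c₂|u|⁵, and the potential
P(u) = ∫₀ᵘ f convex. -/
def NiceF (f : ℝ → ℝ) : Prop :=
  (∃ f₀ : ℝ → ℝ, ContDiff ℝ (⊤ : ℕ∞) f₀ ∧ (∀ v, f v = v * f₀ (v ^ 2)) ∧ ∀ s, 0 ≤ s → 0 ≤ f₀ s) ∧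
  (∃ c₃ c₄ : ℝ, 0 < c₃ ∧ 0 < c₄ ∧
    ∀ v, c₃ * |f v| ≤ |v * deriv f v| ∧ |v * deriv f v| ≤ c₄ * |f v|) ∧
  (∃ c₁ c₂ : ℝ, 0 < c₁ ∧ 0 < c₂ ∧
    ∀ v, c₁ * |v| ^ 5 ≤ |f v| ∧ |f v| ≤ c₂ * |v| ^ 5) ∧
  ConvexOn ℝ Set.univ (fun v => ∫ w in (0:ℝ)..v, f w)

/-- The second-order energy E₂(t) of a solution u. -/
def energy2 (u : ℝ → R3 → ℝ) (t : ℝ) : ℝ :=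
  Real.sqrt ((1 / 2) * (∫ z : R3, (‖gradient (u t) z‖ ^ 2 + (dt u t z) ^ 2))
    + (1 / 2) * ∑ j : Fin 3, ∫ z : R3,
        (‖gradient (fun y => fderiv ℝ (u t) y (EuclideanSpace.single j 1)) z‖ ^ 2
          + (fderiv ℝ (fun y => dt u t y) z (EuclideanSpace.single j 1)) ^ 2))

/-- The derivative of a space-time function in the fixed direction `v`. -/
def dirD (v : ℝ × R3) (W : ℝ × R3 → ℝ) (p : ℝ × R3) : ℝ := fderiv ℝ W p v

/-- The unit time direction. -/
def eT : ℝ × R3 := (1, 0)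

/-- The `i`-th unit space direction. -/
def eX (i : Fin 3) : ℝ × R3 := (0, EuclideanSpace.single i 1)

/-- The d'Alembertian `∂ₜ² - Δ`. -/
def box (W : ℝ × R3 → ℝ) (p : ℝ × R3) : ℝ :=
  dirD eT (dirD eT W) p - ∑ i, dirD (eX i) (dirD (eX i) W) p

/-- The energy density of the linear wave equation. -/
def energyDensity (W : ℝ × R3 → ℝ) (p : ℝ × R3) : ℝ :=
  (1 / 2) * ((∑ i, dirD (eX i) W p ^ 2) + dirD eT W p ^ 2)

lemma energyDensity_nonneg (W : ℝ × R3 → ℝ) (p : ℝ × R3) : 0 ≤ energyDensity W p := by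
  unfold energyDensity; positivity

section dirD

variable {V W : ℝ × R3 → ℝ}

lemma contDiff_dirD (hW : ContDiff ℝ (⊤ : ℕ∞) W) (v : ℝ × R3) :
    ContDiff ℝ (⊤ : ℕ∞) (dirD v W) := by
  unfold dirD
  exact (hW.fderiv_right (m := (⊤ : ℕ∞)) le_rfl).clm_apply contDiff_const

lemma contDiff_energyDensity (hW : ContDiff ℝ (⊤ : ℕ∞) W) :
    ContDiff ℝ (⊤ : ℕ∞) (energyDensity W) := by
  unfold energyDensity
  exact contDiff_const.mul ((ContDiff.sum fun i _ => (contDiff_dirD hW (eX i)).pow 2).add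
    ((contDiff_dirD hW eT).pow 2))

lemma dirD_comm (hW : ContDiff ℝ (⊤ : ℕ∞) W) (v w : ℝ × R3) :
    dirD v (dirD w W) = dirD w (dirD v W) := by
  have hd : Differentiable ℝ (fderiv ℝ W) :=
    (hW.fderiv_right (m := (⊤ : ℕ∞)) le_rfl).differentiable (by simp)
  have key : ∀ (a b : ℝ × R3) p, dirD a (dirD b W) p = fderiv ℝ (fderiv ℝ W) p a b := by
    intro a b p
    unfold dirD
    rw [fderiv_clm_apply (hd p) (by fun_prop)]
    simp
  ext p
  rw [key, key]
  exact (hW.contDiffAt.isSymmSndFDerivAt (by simpa using WithTop.coe_le_coe.2 (le_top (a := (2 : ℕ∞))))).eq v w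

lemma dirD_mul (hV : ContDiff ℝ (⊤ : ℕ∞) V) (hW : ContDiff ℝ (⊤ : ℕ∞) W)
    (v p : ℝ × R3) :
    dirD v (fun q => V q * W q) p = dirD v V p * W p + V p * dirD v W p := by
  unfold dirD
  rw [fderiv_fun_mul (hV.differentiable (by simp) p) (hW.differentiable (by simp) p)]
  simp
  ring

lemma dirD_comp {g : ℝ → ℝ} (hg : Differentiable ℝ g) (hW : ContDiff ℝ (⊤ : ℕ∞) W)
    (v p : ℝ × R3) :
    dirD v (fun q => g (W q)) p = deriv g (W p) * dirD v W p := by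
  unfold dirD
  have h := (hg (W p)).hasDerivAt.comp_hasFDerivAt p (hW.differentiable (by simp) p).hasFDerivAt
  have h2 : fderiv ℝ (fun q => g (W q)) p = deriv g (W p) • fderiv ℝ W p := h.fderiv
  rw [h2]
  simp

lemma dirD_energyDensity (hW : ContDiff ℝ (⊤ : ℕ∞) W) (v p : ℝ × R3) :
    dirD v (energyDensity W) p =
      (∑ i, dirD (eX i) W p * dirD v (dirD (eX i) W) p) + dirD eT W p * dirD v (dirD eT W) p := by
  have h1 : ∀ a, HasFDerivAt (fun q => dirD a W q ^ 2)
      ((2 * dirD a W p) • fderiv ℝ (dirD a W) p) p := fun a => by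
    have := ((contDiff_dirD hW a).differentiable (by simp) p).hasFDerivAt.pow 2
    simpa using this
  have h := ((HasFDerivAt.fun_sum (u := Finset.univ) fun i _ => h1 (eX i)).add (h1 eT)).const_mul
    (1 / 2 : ℝ)
  have h2 : fderiv ℝ (energyDensity W) p = _ := h.fderiv
  rw [dirD, h2]
  simp [dirD, Fin.sum_univ_three]
  ring

lemma hasDerivAt_time (hW : ContDiff ℝ (⊤ : ℕ∞) W) (t : ℝ) (z : R3) :
    HasDerivAt (fun τ => W (τ, z)) (dirD eT W (t, z)) t := by
  have h := (hW.differentiable (by simp) (t, z)).hasFDerivAt.comp_hasDerivAt t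
    ((hasDerivAt_id t).prodMk (hasDerivAt_const t z))
  simpa [dirD, eT, Function.comp_def] using h

lemma fderiv_space (hW : ContDiff ℝ (⊤ : ℕ∞) W) (t : ℝ) (z : R3) (i : Fin 3) :
    fderiv ℝ (fun y => W (t, y)) z (EuclideanSpace.single i 1) = dirD (eX i) W (t, z) := by
  have h := (hW.differentiable (by simp) (t, z)).hasFDerivAt.comp z
    (hasFDerivAt_prodMk_right t z)
  have h2 : fderiv ℝ (fun y => W (t, y)) z = _ := h.fderiv
  rw [h2]
  simp [dirD, eX]

lemma contDiff_slice (hW : ContDiff ℝ (⊤ : ℕ∞) W) (t : ℝ) :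
    ContDiff ℝ (⊤ : ℕ∞) (fun z => W (t, z)) :=
  hW.comp (contDiff_const.prodMk contDiff_id)

lemma dirD_space_eq_zero (hW : ContDiff ℝ (⊤ : ℕ∞) W) {t : ℝ} {s : Set R3} (hs : IsClosed s)
    (h : ∀ z ∉ s, W (t, z) = 0) (i : Fin 3) : ∀ z ∉ s, dirD (eX i) W (t, z) = 0 := by
  intro z hz
  rw [← fderiv_space hW]
  have : (fun y => W (t, y)) =ᶠ[nhds z] fun _ => 0 := by
    filter_upwards [hs.isOpen_compl.mem_nhds hz] with y hy using h y hy
  rw [this.fderiv_eq]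
  simp

/-- A function vanishing near a time slice outside a spatial set has vanishing time derivative
there. -/
lemma dirD_time_eq_zero (hW : ContDiff ℝ (⊤ : ℕ∞) W) {t₀ : ℝ} {s : Set R3}
    (h : ∀ t ∈ ball t₀ 1, ∀ z ∉ s, W (t, z) = 0) :
    ∀ t ∈ ball t₀ 1, ∀ z ∉ s, dirD eT W (t, z) = 0 := by
  intro t ht z hz
  rw [← (hasDerivAt_time hW t z).deriv]
  have : (fun τ => W (τ, z)) =ᶠ[nhds t] fun _ => 0 := by
    filter_upwards [isOpen_ball.mem_nhds ht] with τ hτ using h τ hτ z hz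
  rw [this.deriv_eq]
  simp

end dirD

/-- Differentiation under the integral sign for functions with compact spatial support. -/
lemma hasDerivAt_integral_space {g : ℝ × R3 → ℝ} (hg : ContDiff ℝ (⊤ : ℕ∞) g) {K : Set R3}
    (hK : IsCompact K) {t₀ : ℝ} (h0 : ∀ t ∈ ball t₀ 1, ∀ z ∉ K, g (t, z) = 0) :
    HasDerivAt (fun t => ∫ z, g (t, z)) (∫ z, dirD eT g (t₀, z)) t₀ := by
  have hcd := (contDiff_dirD hg eT).continuous
  obtain ⟨C, hC⟩ := ((isCompact_closedBall t₀ 1).prod hK).exists_bound_of_continuousOn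
    hcd.continuousOn
  have ht₀ : t₀ ∈ ball t₀ 1 := mem_ball_self one_pos
  have hcs : ∀ t, Continuous fun z => g (t, z) := fun t => (contDiff_slice hg t).continuous
  have hv := dirD_time_eq_zero hg h0
  refine (hasDerivAt_integral_of_dominated_loc_of_deriv_le (s := ball t₀ 1)
    (F := fun t z => g (t, z)) (F' := fun t z => dirD eT g (t, z))
    (bound := K.indicator fun _ => C) (isOpen_ball.mem_nhds ht₀)
    (Eventually.of_forall fun t => (hcs t).aestronglyMeasurable)
    ((hcs t₀).integrable_of_hasCompactSupport (HasCompactSupport.intro hK (h0 t₀ ht₀)))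
    (hcd.comp (Continuous.prodMk_right t₀)).aestronglyMeasurable
    (Eventually.of_forall fun z t ht => ?_) ?_
    (Eventually.of_forall fun z t ht => hasDerivAt_time hg t z)).2
  · by_cases hz : z ∈ K
    · rw [Set.indicator_of_mem hz]
      exact hC (t, z) ⟨ball_subset_closedBall ht, hz⟩
    · rw [Set.indicator_of_notMem hz, hv t ht z hz, norm_zero]
  · exact (integrable_indicator_iff hK.measurableSet).2
      (integrableOn_const hK.measure_lt_top.ne)

/-- Spatial integration by parts on a time slice. -/
lemma integral_mul_dirD_space {V W : ℝ × R3 → ℝ} (hV : ContDiff ℝ (⊤ : ℕ∞) V)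
    (hW : ContDiff ℝ (⊤ : ℕ∞) W) {K : Set R3} (hK : IsCompact K) {t : ℝ}
    (h0 : ∀ z ∉ K, V (t, z) = 0) (i : Fin 3) :
    ∫ z, V (t, z) * dirD (eX i) W (t, z) = -∫ z, dirD (eX i) V (t, z) * W (t, z) := by
  have h0' := dirD_space_eq_zero hV hK.isClosed h0 i
  have cV := (contDiff_slice hV t)
  have cW := (contDiff_slice hW t)
  have cV' := (contDiff_slice (contDiff_dirD hV (eX i)) t).continuous
  have cW' := (contDiff_slice (contDiff_dirD hW (eX i)) t).continuous
  have := integral_mul_fderiv_eq_neg_fderiv_mul_of_integrable (μ := (volume : Measure R3))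
    (f := fun z => V (t, z)) (g := fun z => W (t, z)) (v := EuclideanSpace.single i 1)
    ?_ ?_ ?_ (fun z _ => cV.differentiable (by simp) z) (fun z _ => cW.differentiable (by simp) z)
  · simpa only [fderiv_space hV, fderiv_space hW] using this
  · simp only [fderiv_space hV]
    exact (cV'.mul cW.continuous).integrable_of_hasCompactSupport
      (HasCompactSupport.intro hK fun z hz => by simp [h0' z hz])
  · simp only [fderiv_space hW]
    exact (cV.continuous.mul cW').integrable_of_hasCompactSupport
      (HasCompactSupport.intro hK fun z hz => by simp [h0 z hz])
  · exact (cV.continuous.mul cW.continuous).integrable_of_hasCompactSupport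
      (HasCompactSupport.intro hK fun z hz => by simp [h0 z hz])

/-- The weighted energy identity for the linear wave operator. -/
lemma hasDerivAt_weighted_energy {χ W : ℝ × R3 → ℝ} (hχ : ContDiff ℝ (⊤ : ℕ∞) χ)
    (hW : ContDiff ℝ (⊤ : ℕ∞) W) {K : Set R3} (hK : IsCompact K) {t₀ : ℝ}
    (h0 : ∀ t ∈ ball t₀ 1, ∀ z ∉ K, χ (t, z) = 0) :
    HasDerivAt (fun t => ∫ z, χ (t, z) * energyDensity W (t, z))
      (∫ z, (dirD eT χ (t₀, z) * energyDensity W (t₀, z)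
        + χ (t₀, z) * (dirD eT W (t₀, z) * box W (t₀, z))
        - dirD eT W (t₀, z) * ∑ i, dirD (eX i) χ (t₀, z) * dirD (eX i) W (t₀, z))) t₀ := by
  have hE := contDiff_energyDensity hW
  have h := hasDerivAt_integral_space (hχ.mul hE) hK (t₀ := t₀)
    (fun t ht z hz => by simp [h0 t ht z hz])
  have ht₀ : t₀ ∈ ball t₀ 1 := mem_ball_self one_pos
  have hχ0 := h0 t₀ ht₀
  have hχ0' := fun i => dirD_space_eq_zero hχ hK.isClosed hχ0 i
  have hWt := contDiff_dirD hW eT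
  have hWi := fun i => contDiff_dirD hW (eX i)
  have hibp : ∀ i, ∫ z, (χ (t₀, z) * dirD (eX i) W (t₀, z) * dirD (eX i) (dirD eT W) (t₀, z)
      + (dirD (eX i) χ (t₀, z) * dirD (eX i) W (t₀, z)
        + χ (t₀, z) * dirD (eX i) (dirD (eX i) W) (t₀, z)) * dirD eT W (t₀, z)) = 0 := by
    intro i
    have hp := integral_mul_dirD_space (hχ.mul (hWi i)) hWt hK (t := t₀)
      (fun z hz => by simp [hχ0 z hz]) i
    simp only [dirD_mul hχ (hWi i)] at hp
    rw [integral_add, hp, neg_add_cancel]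
    · exact (((contDiff_slice (hχ.mul (hWi i)) t₀).continuous).mul
        (contDiff_slice (contDiff_dirD hWt (eX i)) t₀).continuous).integrable_of_hasCompactSupport
        (HasCompactSupport.intro hK fun z hz => by simp [hχ0 z hz])
    · refine (contDiff_slice ((((contDiff_dirD hχ (eX i)).mul (hWi i)).add
        (hχ.mul (contDiff_dirD (hWi i) (eX i)))).mul hWt)
        t₀).continuous.integrable_of_hasCompactSupport
        (HasCompactSupport.intro hK fun z hz => ?_)
      simp [hχ0 z hz, hχ0' i z hz]
  refine h.congr_deriv ?_
  have hint : ∀ i, Integrable fun z => (χ (t₀, z) * dirD (eX i) W (t₀, z)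
      * dirD (eX i) (dirD eT W) (t₀, z)
      + (dirD (eX i) χ (t₀, z) * dirD (eX i) W (t₀, z)
        + χ (t₀, z) * dirD (eX i) (dirD (eX i) W) (t₀, z)) * dirD eT W (t₀, z)) := by
    intro i
    refine (contDiff_slice (((hχ.mul (hWi i)).mul (contDiff_dirD hWt (eX i))).add
      ((((contDiff_dirD hχ (eX i)).mul (hWi i)).add
        (hχ.mul (contDiff_dirD (hWi i) (eX i)))).mul hWt))
        t₀).continuous.integrable_of_hasCompactSupport
        (HasCompactSupport.intro hK fun z hz => ?_)
    simp [hχ0 z hz, hχ0' i z hz]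
  have hsum : ∫ z, ∑ i, (χ (t₀, z) * dirD (eX i) W (t₀, z) * dirD (eX i) (dirD eT W) (t₀, z)
      + (dirD (eX i) χ (t₀, z) * dirD (eX i) W (t₀, z)
        + χ (t₀, z) * dirD (eX i) (dirD (eX i) W) (t₀, z)) * dirD eT W (t₀, z)) = 0 := by
    rw [integral_finsetSum _ fun i _ => hint i]
    simp [hibp]
  have hL : Integrable fun z => dirD eT (fun q => χ q * energyDensity W q) (t₀, z) := by
    refine (contDiff_slice (contDiff_dirD (hχ.mul hE) eT)
      t₀).continuous.integrable_of_hasCompactSupport (HasCompactSupport.intro hK fun z hz => ?_)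
    exact dirD_time_eq_zero (hχ.mul hE) (fun t ht z hz => by simp [h0 t ht z hz]) t₀ ht₀ z hz
  rw [← sub_zero (∫ z, _), ← hsum, ← integral_sub hL (integrable_finsetSum _ fun i _ => hint i)]
  refine integral_congr_ae (Eventually.of_forall fun z => ?_)
  simp only [dirD_mul hχ hE, dirD_energyDensity hW, box, dirD_comm hW eT (eX _),
    Fin.sum_univ_three]
  ring

/-- The weight `ψ((T - t)² - |z - z₀|²)` localising to the backward light cone from `(T, z₀)`. -/
def coneWeight (T : ℝ) (z₀ : R3) (p : ℝ × R3) : ℝ :=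
  expNegInvGlue ((T - p.1) ^ 2 - ‖p.2 - z₀‖ ^ 2)

section coneWeight

variable {T : ℝ} {z₀ : R3}

lemma contDiff_coneWeight (T : ℝ) (z₀ : R3) : ContDiff ℝ (⊤ : ℕ∞) (coneWeight T z₀) := by
  unfold coneWeight
  exact expNegInvGlue.contDiff.comp (((contDiff_const.sub contDiff_fst).pow 2).sub
    ((contDiff_snd.sub contDiff_const).norm_sq ℝ))

lemma coneWeight_eq_zero {t : ℝ} {z : R3} (h : |T - t| ≤ ‖z - z₀‖) :
    coneWeight T z₀ (t, z) = 0 := by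
  refine expNegInvGlue.zero_of_nonpos ?_
  have := sq_le_sq' (by linarith [abs_nonneg (T - t), norm_nonneg (z - z₀)]) h
  rw [sq_abs] at this
  simpa using this

lemma dirD_coneWeight (v p : ℝ × R3) :
    dirD v (coneWeight T z₀) p = deriv expNegInvGlue ((T - p.1) ^ 2 - ‖p.2 - z₀‖ ^ 2) *
      (-2 * (T - p.1) * v.1 - 2 * inner ℝ (p.2 - z₀) v.2) := by
  have hd : Differentiable ℝ expNegInvGlue :=
    (expNegInvGlue.contDiff (n := 1)).differentiable (by simp)
  have h1 : HasFDerivAt (fun q : ℝ × R3 => (T - q.1) ^ 2) _ p :=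
    ((hasFDerivAt_fst (𝕜 := ℝ) (p := p)).const_sub T).pow 2
  have h2 : HasFDerivAt (fun q : ℝ × R3 => ‖q.2 - z₀‖ ^ 2) _ p :=
    ((hasFDerivAt_snd (𝕜 := ℝ) (p := p)).sub_const z₀).norm_sq
  have h := (hd _).hasDerivAt.comp_hasFDerivAt p (h1.sub h2)
  have h3 : fderiv ℝ (coneWeight T z₀) p = _ := h.fderiv
  rw [dirD, h3]
  simp [innerSL_apply_apply, inner_sub_left]

lemma deriv_expNegInvGlue_nonneg (s : ℝ) : 0 ≤ deriv expNegInvGlue s :=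
  expNegInvGlue.monotone.deriv_nonneg

lemma deriv_expNegInvGlue_of_nonpos {s : ℝ} (hs : s ≤ 0) : deriv expNegInvGlue s = 0 :=
  IsLocalMin.deriv_eq_zero (Eventually.of_forall fun x => by
    rw [expNegInvGlue.zero_of_nonpos hs]; exact expNegInvGlue.nonneg x)

/-- The cone weight decreases in time at least as fast as it varies in space. -/
lemma coneWeight_flux_nonpos {t : ℝ} (ht : t ≤ T) (z : R3) (W : ℝ × R3 → ℝ) {c : ℝ}
    (hc : 0 ≤ c) :
    dirD eT (coneWeight T z₀) (t, z) * (energyDensity W (t, z) + c)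
      - dirD eT W (t, z) * ∑ i, dirD (eX i) (coneWeight T z₀) (t, z) * dirD (eX i) W (t, z)
      ≤ 0 := by
  simp only [dirD_coneWeight]
  have hn := EuclideanSpace.real_norm_sq_eq (z - z₀)
  set s := (T - t) ^ 2 - ‖z - z₀‖ ^ 2 with hs
  rcases le_or_gt s 0 with h | h
  · simp [deriv_expNegInvGlue_of_nonpos h]
  have hp := deriv_expNegInvGlue_nonneg s
  set k := deriv expNegInvGlue s
  rw [Fin.sum_univ_three] at hn
  simp only [eT, eX, energyDensity, Fin.sum_univ_three, EuclideanSpace.inner_single_right,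
    inner_zero_right]
  set a := dirD (1, 0) W (t, z)
  set b0 := dirD (0, EuclideanSpace.single 0 1) W (t, z)
  set b1 := dirD (0, EuclideanSpace.single 1 1) W (t, z)
  set b2 := dirD (0, EuclideanSpace.single 2 1) W (t, z)
  set d0 := (z - z₀) 0
  set d1 := (z - z₀) 1
  set d2 := (z - z₀) 2
  have hr : 0 < T - t := by
    rcases ht.lt_or_eq with h' | h'
    · linarith
    · rw [h', sub_self] at hs
      nlinarith [sq_nonneg ‖z - z₀‖]
  set r := T - t
  have hd : d0 ^ 2 + d1 ^ 2 + d2 ^ 2 ≤ r ^ 2 := by linarith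
  have hcs : (d0 * b0 + d1 * b1 + d2 * b2) ^ 2 ≤ r ^ 2 * (b0 ^ 2 + b1 ^ 2 + b2 ^ 2) := by
    have := mul_le_mul_of_nonneg_right hd (by positivity : 0 ≤ b0 ^ 2 + b1 ^ 2 + b2 ^ 2)
    nlinarith [sq_nonneg (d0 * b1 - d1 * b0), sq_nonneg (d0 * b2 - d2 * b0),
      sq_nonneg (d1 * b2 - d2 * b1)]
  have hm : 2 * r * (a * (d0 * b0 + d1 * b1 + d2 * b2)) ≤
      r * (r * (a ^ 2 + (b0 ^ 2 + b1 ^ 2 + b2 ^ 2))) := by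
    nlinarith [sq_nonneg (r * a - (d0 * b0 + d1 * b1 + d2 * b2))]
  have hm' : 2 * (a * (d0 * b0 + d1 * b1 + d2 * b2)) ≤
      r * (a ^ 2 + (b0 ^ 2 + b1 ^ 2 + b2 ^ 2)) := by
    refine le_of_mul_le_mul_left ?_ hr
    linarith
  have hfin : 0 ≤ k * (r * (a ^ 2 + (b0 ^ 2 + b1 ^ 2 + b2 ^ 2)) + 2 * r * c
      - 2 * (a * (d0 * b0 + d1 * b1 + d2 * b2))) :=
    mul_nonneg hp (by nlinarith [mul_nonneg hr.le hc])
  simp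
  linarith

end coneWeight

/-- Finite speed of propagation for the defocusing semilinear wave equation. -/
lemma finite_speed {F : ℝ → ℝ} (hF : ContDiff ℝ (⊤ : ℕ∞) F) (hF0 : ∀ v, 0 ≤ F v)
    (hF00 : F 0 = 0) {U : ℝ × R3 → ℝ} (hU : ContDiff ℝ (⊤ : ℕ∞) U)
    (hbox : ∀ p, box U p = -deriv F (U p)) {T : ℝ} {z₀ : R3}
    (h0 : ∀ z ∈ ball z₀ T, U (0, z) = 0) (h1 : ∀ z ∈ ball z₀ T, dirD eT U (0, z) = 0)
    {t : ℝ} (ht0 : 0 ≤ t) (htT : t < T) :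
    U (t, z₀) = 0 ∧ dirD eT U (t, z₀) = 0 := by
  have hT : 0 < T := ht0.trans_lt htT
  set χ := coneWeight T z₀
  have hχ : ContDiff ℝ (⊤ : ℕ∞) χ := contDiff_coneWeight T z₀
  have hχnn : ∀ p, 0 ≤ χ p := fun p => expNegInvGlue.nonneg _
  have hFU : ContDiff ℝ (⊤ : ℕ∞) fun q => F (U q) := hF.comp hU
  have hE := contDiff_energyDensity hU
  have hK := isCompact_closedBall z₀ (T + 1)
  have hsupp : ∀ s ∈ Set.Icc 0 T, ∀ t ∈ ball s 1, ∀ z ∉ closedBall z₀ (T + 1),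
      χ (t, z) = 0 := by
    intro s hs t ht z hz
    refine coneWeight_eq_zero ?_
    rw [mem_closedBall, not_le, dist_eq_norm] at hz
    rw [mem_ball, Real.dist_eq, abs_lt] at ht
    refine le_trans (abs_le.2 ⟨?_, ?_⟩) hz.le <;> linarith [hs.1, hs.2, ht.1, ht.2]
  have hG : ∀ s ∈ Set.Icc 0 T, ∃ D ≤ 0, HasDerivAt (fun t =>
      (∫ z, χ (t, z) * energyDensity U (t, z)) + ∫ z, χ (t, z) * F (U (t, z))) D s := by
    intro s hs
    have hs1 : s ∈ ball s 1 := mem_ball_self one_pos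
    have hsu := hsupp s hs
    refine ⟨_, ?_, (hasDerivAt_weighted_energy hχ hU hK hsu).add
      (hasDerivAt_integral_space (hχ.mul hFU) hK fun t ht z hz => by simp [hsu t ht z hz])⟩
    have hχt := dirD_time_eq_zero hχ hsu s hs1
    have hχx := fun i => dirD_space_eq_zero hχ isClosed_closedBall (hsu s hs1) i
    have hUt := contDiff_dirD hU eT
    have hbs : ContDiff ℝ (⊤ : ℕ∞) (box U) := by
      unfold box
      exact (contDiff_dirD hUt eT).sub
        (ContDiff.sum fun i _ => contDiff_dirD (contDiff_dirD hU (eX i)) (eX i))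
    rw [← integral_add]
    · refine integral_nonpos fun z => ?_
      have hfl := coneWeight_flux_nonpos (z₀ := z₀) hs.2 z U (hF0 (U (s, z)))
      simp only [dirD_mul hχ hFU, dirD_comp (hF.differentiable (by simp)) hU, hbox, Pi.zero_apply]
      refine le_trans (le_of_eq ?_) hfl
      ring
    · refine (contDiff_slice ((((contDiff_dirD hχ eT).mul hE).add (hχ.mul (hUt.mul hbs))).sub
        (hUt.mul (ContDiff.sum fun i _ => (contDiff_dirD hχ (eX i)).mul
          (contDiff_dirD hU (eX i))))) s).continuous.integrable_of_hasCompactSupport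
        (HasCompactSupport.intro hK fun z hz => ?_)
      simp [hχt z hz, hχx _ z hz, hsu s hs1 z hz]
    · refine (contDiff_slice (contDiff_dirD (hχ.mul hFU) eT) s).continuous
        |>.integrable_of_hasCompactSupport (HasCompactSupport.intro hK fun z hz => ?_)
      exact dirD_time_eq_zero (hχ.mul hFU) (fun t ht z hz => by simp [hsu t ht z hz]) s hs1 z hz
  have hanti := antitoneOn_of_deriv_nonpos (convex_Icc 0 T)
    (f := fun t => (∫ z, χ (t, z) * energyDensity U (t, z)) + ∫ z, χ (t, z) * F (U (t, z)))
    (fun s hs => by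
      obtain ⟨D, -, h⟩ := hG s hs
      exact h.continuousAt.continuousWithinAt)
    (fun s hs => by
      obtain ⟨D, -, h⟩ := hG s (interior_subset hs)
      exact h.differentiableAt.differentiableWithinAt)
    (fun s hs => by
      obtain ⟨D, hD, h⟩ := hG s (interior_subset hs)
      rwa [h.deriv])
  have hx0 : ∀ i, ∀ z ∉ (ball z₀ T)ᶜ, dirD (eX i) U (0, z) = 0 := fun i =>
    dirD_space_eq_zero hU isOpen_ball.isClosed_compl (fun z hz => h0 z (by simpa using hz)) i
  have hzero : (∫ z, χ (0, z) * energyDensity U (0, z)) + ∫ z, χ (0, z) * F (U (0, z)) = 0 := by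
    have : ∀ z, χ (0, z) * energyDensity U (0, z) = 0 ∧ χ (0, z) * F (U (0, z)) = 0 := by
      intro z
      by_cases hz : z ∈ ball z₀ T
      · have := fun i => hx0 i z (by simpa using hz)
        simp [energyDensity, h0 z hz, h1 z hz, this, hF00]
      · have : χ (0, z) = 0 := coneWeight_eq_zero (by
          rw [mem_ball, not_lt, dist_eq_norm] at hz
          rwa [sub_zero, abs_of_pos hT])
        simp [this]
    simp [fun z => (this z).1, fun z => (this z).2]
  have hut : ∀ s ∈ Set.Ico 0 T, dirD eT U (s, z₀) = 0 := by
    intro s hs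
    have hle := hanti ⟨le_rfl, hT.le⟩ (Set.Ico_subset_Icc_self hs) hs.1
    simp only [hzero] at hle
    have hFn : 0 ≤ ∫ z, χ (s, z) * F (U (s, z)) :=
      integral_nonneg fun z => mul_nonneg (hχnn _) (hF0 _)
    have hc : Continuous fun z => χ (s, z) * energyDensity U (s, z) :=
      (contDiff_slice (hχ.mul hE) s).continuous
    have hnn : ∀ z, 0 ≤ χ (s, z) * energyDensity U (s, z) := fun z =>
      mul_nonneg (hχnn _) (energyDensity_nonneg _ _)
    have hi : Integrable fun z => χ (s, z) * energyDensity U (s, z) :=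
      hc.integrable_of_hasCompactSupport (HasCompactSupport.intro hK fun z hz => by
        simp [hsupp s (Set.Ico_subset_Icc_self hs) s (mem_ball_self one_pos) z hz])
    have hz : ∫ z, χ (s, z) * energyDensity U (s, z) = 0 :=
      le_antisymm (by linarith) (integral_nonneg hnn)
    rw [integral_eq_zero_iff_of_nonneg hnn hi] at hz
    have hz' : χ (s, z₀) * energyDensity U (s, z₀) = 0 := congrFun ((hc.ae_eq_iff_eq volume continuous_const).1 hz) z₀
    have hpos : 0 < χ (s, z₀) := expNegInvGlue.pos_of_pos (by
      have : 0 < T - s := by linarith [hs.2]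
      simp
      positivity)
    have he : energyDensity U (s, z₀) = 0 :=
      (mul_eq_zero.1 hz').resolve_left hpos.ne'
    have hsum : 0 ≤ ∑ i, dirD (eX i) U (s, z₀) ^ 2 := by positivity
    unfold energyDensity at he
    exact pow_eq_zero_iff (two_ne_zero) |>.1
      (le_antisymm (by linarith) (sq_nonneg (dirD eT U (s, z₀))))
  refine ⟨?_, hut t ⟨ht0, htT⟩⟩
  rw [constant_of_has_deriv_right_zero (f := fun τ => U (τ, z₀)) (a := 0) (b := t)
    (fun s _ => (hasDerivAt_time hU s z₀).continuousAt.continuousWithinAt)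
    (fun s hs => by
      have := hasDerivAt_time hU s z₀
      rw [hut s ⟨hs.1, hs.2.trans htT⟩] at this
      exact this.hasDerivWithinAt) t ⟨ht0, le_rfl⟩]
  exact h0 z₀ (mem_ball_self hT)

lemma norm_gradient_sq (g : R3 → ℝ) (z : R3) :
    ‖gradient g z‖ ^ 2 = ∑ i, fderiv ℝ g z (EuclideanSpace.single i 1) ^ 2 := by
  rw [EuclideanSpace.real_norm_sq_eq]
  refine Finset.sum_congr rfl fun i _ => ?_
  rw [← inner_gradient_left, EuclideanSpace.inner_single_right]
  simp

lemma norm_fderiv_sq (g : R3 → ℝ) (z : R3) :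
    ‖fderiv ℝ g z‖ ^ 2 = ∑ i, fderiv ℝ g z (EuclideanSpace.single i 1) ^ 2 := by
  rw [← norm_gradient_sq, gradient, LinearIsometryEquiv.norm_map]

/-- The Sobolev inequality `‖v‖_{L⁶} ≤ S ‖∇v‖_{L²}` on `ℝ³`, with real integrals. -/
lemma exists_sobolev : ∃ S : ℝ, 0 < S ∧ ∀ v : R3 → ℝ, ContDiff ℝ 1 v → HasCompactSupport v →
    (∫ z, |v z| ^ 6) ^ ((1 : ℝ) / 6) ≤
      S * √(∫ z, ∑ i, fderiv ℝ v z (EuclideanSpace.single i 1) ^ 2) := by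
  set c := eLpNormLESNormFDerivOfEqInnerConst (volume : Measure R3) ((2 : NNReal) : ℝ) with hc
  refine ⟨c + 1, by positivity, fun v hv hvs => ?_⟩
  have h := eLpNorm_le_eLpNorm_fderiv_of_eq_inner (volume : Measure R3) hv hvs (p := 2) (p' := 6)
    (by norm_num) (by simp) (by simp; norm_num)
  have hd : Continuous (fderiv ℝ v) := hv.continuous_fderiv (by simp)
  have m1 : MemLp v (6 : NNReal) volume := hv.continuous.memLp_of_hasCompactSupport hvs
  have m3 : MemLp (fderiv ℝ v) (2 : NNReal) volume := hd.memLp_of_hasCompactSupport (hvs.fderiv ℝ)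
  rw [m1.eLpNorm_eq_integral_rpow_norm (by simp) (by simp),
    m3.eLpNorm_eq_integral_rpow_norm (by simp) (by simp), ← hc, ← ENNReal.ofReal_coe_nnreal (p := c),
    ← ENNReal.ofReal_mul (by positivity), ENNReal.ofReal_le_ofReal_iff (by positivity)] at h
  have e6 : ((6 : NNReal) : ENNReal).toReal = (6 : ℕ) := by simp
  have e2 : ((2 : NNReal) : ENNReal).toReal = (2 : ℕ) := by simp
  simp only [e6, e2, Real.rpow_natCast, norm_fderiv_sq, Real.norm_eq_abs] at h
  rw [Real.sqrt_eq_rpow]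
  have h' : (∫ z, |v z| ^ 6) ^ ((1 : ℝ) / 6) ≤
      c *
      (∫ z, ∑ i, fderiv ℝ v z (EuclideanSpace.single i 1) ^ 2) ^ ((1 : ℝ) / 2) := by
    simpa using h
  refine h'.trans (mul_le_mul_of_nonneg_right (by linarith) (by positivity))

/-- Hölder's inequality with exponents `3`, `6`, `2` applied to `|u|⁴ |v| |w|`. -/
lemma integral_quartic_le {u v w : R3 → ℝ} (hu : Continuous u) (hus : HasCompactSupport u)
    (hv : Continuous v) (hvs : HasCompactSupport v) (hw : Continuous w)
    (hws : HasCompactSupport w) :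
    ∫ z, |u z| ^ 4 * |v z| * |w z| ≤
      (∫ z, |u z| ^ 12) ^ ((1 : ℝ) / 3) * (∫ z, |v z| ^ 6) ^ ((1 : ℝ) / 6) * √(∫ z, w z ^ 2) := by
  have hs4 : HasCompactSupport fun z => |u z| ^ 4 := hus.comp_left (g := fun x => |x| ^ 4) (by simp)
  have hs8 : HasCompactSupport fun z => |u z| ^ 8 := hus.comp_left (g := fun x => |x| ^ 8) (by simp)
  have hv2 : HasCompactSupport fun z => |v z| ^ 2 := hvs.comp_left (g := fun x => |x| ^ 2) (by simp)
  have hwa : HasCompactSupport fun z => |w z| := hws.comp_left (g := fun x => |x|) (by simp)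
  have h1 := integral_mul_le_Lp_mul_Lq_of_nonneg (μ := (volume : Measure R3))
    Real.HolderConjugate.two_two (f := fun z => |u z| ^ 4 * |v z|) (g := fun z => |w z|)
    (Eventually.of_forall fun z => by positivity) (Eventually.of_forall fun z => by positivity)
    (((hu.abs.pow 4).mul hv.abs).memLp_of_hasCompactSupport hs4.mul_right)
    (hw.abs.memLp_of_hasCompactSupport hwa)
  have h2 := integral_mul_le_Lp_mul_Lq_of_nonneg (μ := (volume : Measure R3))
    (p := 3 / 2) (q := 3) (Real.holderConjugate_iff.2 ⟨by norm_num, by norm_num⟩)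
    (f := fun z => |u z| ^ 8) (g := fun z => |v z| ^ 2)
    (Eventually.of_forall fun z => by positivity) (Eventually.of_forall fun z => by positivity)
    ((hu.abs.pow 8).memLp_of_hasCompactSupport hs8)
    ((hv.abs.pow 2).memLp_of_hasCompactSupport hv2)
  have e1 : ∀ z, (|u z| ^ 8 : ℝ) ^ (3 / 2 : ℝ) = |u z| ^ 12 := fun z => by
    rw [← Real.rpow_natCast, ← Real.rpow_mul (abs_nonneg _), ← Real.rpow_natCast]
    norm_num
  have e2 : ∀ z, (|v z| ^ 2 : ℝ) ^ (3 : ℝ) = |v z| ^ 6 := fun z => by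
    rw [← Real.rpow_natCast, ← Real.rpow_mul (abs_nonneg _), ← Real.rpow_natCast]
    norm_num
  have e3 : ∀ z, (|u z| ^ 4 * |v z|) ^ (2 : ℝ) = |u z| ^ 8 * |v z| ^ 2 := fun z => by
    rw [Real.rpow_two]; ring
  have e4 : ∀ z, |w z| ^ (2 : ℝ) = w z ^ 2 := fun z => by rw [Real.rpow_two, sq_abs]
  simp only [e1, e2] at h2
  simp only [e3, e4] at h1
  have A : 0 ≤ ∫ z, |u z| ^ 12 := integral_nonneg fun z => by positivity
  have B : 0 ≤ ∫ z, |v z| ^ 6 := integral_nonneg fun z => by positivity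
  have h3 := Real.rpow_le_rpow (integral_nonneg fun z => by positivity) h2
    (by norm_num : (0 : ℝ) ≤ 1 / 2)
  rw [Real.mul_rpow (by positivity) (by positivity), ← Real.rpow_mul A, ← Real.rpow_mul B] at h3
  norm_num at h3
  rw [Real.sqrt_eq_rpow]
  refine h1.trans (mul_le_mul_of_nonneg_right ?_ (by positivity))
  norm_num
  exact h3

/-- The trilinear bound controlling the nonlinear term by the linear energy. -/
lemma exists_quartic_energy_bound : ∃ S : ℝ, 0 < S ∧ ∀ u v w : R3 → ℝ,
    Continuous u → HasCompactSupport u → ContDiff ℝ 1 v → HasCompactSupport v →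
    Continuous w → HasCompactSupport w →
    ∫ z, |u z| ^ 4 * |v z| * |w z| ≤ S * (∫ z, |u z| ^ 12) ^ ((1 : ℝ) / 3) *
      ∫ z, (1 / 2) * ((∑ i, fderiv ℝ v z (EuclideanSpace.single i 1) ^ 2) + w z ^ 2) := by
  obtain ⟨S, hS, h⟩ := exists_sobolev
  refine ⟨S, hS, fun u v w hu hus hv hvs hw hws => ?_⟩
  have hd : Continuous (fderiv ℝ v) := hv.continuous_fderiv (by simp)
  have i1 : Integrable fun z => ∑ i, fderiv ℝ v z (EuclideanSpace.single i 1) ^ 2 := by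
    refine Continuous.integrable_of_hasCompactSupport (by fun_prop) ?_
    exact (hvs.fderiv ℝ).comp_left
      (g := fun L : R3 →L[ℝ] ℝ => ∑ i, L (EuclideanSpace.single i 1) ^ 2) (by simp)
  have hw2 : HasCompactSupport fun z => w z ^ 2 := hws.comp_left (g := fun x => x ^ 2) (by simp)
  have i2 : Integrable fun z => w z ^ 2 := (hw.pow 2).integrable_of_hasCompactSupport hw2
  have A : 0 ≤ ∫ z, ∑ i, fderiv ℝ v z (EuclideanSpace.single i 1) ^ 2 :=
    integral_nonneg fun z => by positivity
  have B : 0 ≤ ∫ z, w z ^ 2 := integral_nonneg fun z => by positivity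
  have hH : 0 ≤ (∫ z, |u z| ^ 12) ^ ((1 : ℝ) / 3) :=
    Real.rpow_nonneg (integral_nonneg fun z => by positivity) _
  have hab : ∀ a b : ℝ, 0 ≤ a → 0 ≤ b → √a * √b ≤ 1 / 2 * (a + b) := fun a b ha hb => by
    nlinarith [sq_nonneg (√a - √b), Real.sq_sqrt ha, Real.sq_sqrt hb]
  rw [integral_const_mul, integral_add i1 i2]
  refine (integral_quartic_le hu hus hv.continuous hvs hw hws).trans ?_
  refine (mul_le_mul_of_nonneg_right (mul_le_mul_of_nonneg_left (h v hv hvs) hH)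
    (Real.sqrt_nonneg _)).trans ?_
  rw [← mul_assoc, mul_comm _ S, mul_assoc]
  exact mul_le_mul_of_nonneg_left (hab _ _ A B) (mul_nonneg hS.le hH)

/-- Energy estimate for solutions `W` of a linear wave equation with potential of size `|U|⁴`. -/
lemma integral_energyDensity_le {S M : ℝ} (hM : 0 ≤ M)
    (hS : ∀ u v w : R3 → ℝ,
      Continuous u → HasCompactSupport u → ContDiff ℝ 1 v → HasCompactSupport v →
      Continuous w → HasCompactSupport w →
      ∫ z, |u z| ^ 4 * |v z| * |w z| ≤ S * (∫ z, |u z| ^ 12) ^ ((1 : ℝ) / 3) *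
        ∫ z, (1 / 2) * ((∑ i, fderiv ℝ v z (EuclideanSpace.single i 1) ^ 2) + w z ^ 2))
    {U W : ℝ × R3 → ℝ} (hU : ContDiff ℝ (⊤ : ℕ∞) U) (hW : ContDiff ℝ (⊤ : ℕ∞) W)
    {T ρ : ℝ} (hT : 0 ≤ T)
    (hU0 : ∀ t ∈ Set.Icc 0 T, ∀ z ∉ closedBall (0 : R3) ρ, U (t, z) = 0)
    (hW0 : ∀ t ∈ Set.Icc 0 T, ∀ z ∉ closedBall (0 : R3) ρ, W (t, z) = 0)
    (hWt0 : ∀ t ∈ Set.Icc 0 T, ∀ z ∉ closedBall (0 : R3) ρ, dirD eT W (t, z) = 0)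
    (hbox : ∀ p, |box W p| ≤ M * (|U p| ^ 4 * |W p|)) :
    ∫ z, energyDensity W (T, z) ≤ (∫ z, energyDensity W (0, z)) *
      Real.exp (M * S * ∫ τ in (0 : ℝ)..T, (∫ z, |U (τ, z)| ^ 12) ^ ((1 : ℝ) / 3)) := by
  let β : ContDiffBump (0 : R3) := ⟨|ρ| + 1, |ρ| + 2, by positivity, by linarith⟩
  set χ : ℝ × R3 → ℝ := fun p => β p.2 with hχdef
  have hχ : ContDiff ℝ (⊤ : ℕ∞) χ := β.contDiff.comp contDiff_snd
  have hKρ := isCompact_closedBall (0 : R3) ρ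
  have hK := isCompact_closedBall (0 : R3) (|ρ| + 2)
  have hχ0 : ∀ t, ∀ z ∉ closedBall (0 : R3) (|ρ| + 2), χ (t, z) = 0 := fun t z hz =>
    β.zero_of_le_dist (by
      rw [mem_closedBall, not_le] at hz
      exact hz.le)
  have hlt : ∀ z ∈ closedBall (0 : R3) ρ, z ∈ ball (0 : R3) (|ρ| + 1) := fun z hz => by
    rw [mem_closedBall] at hz
    rw [mem_ball]
    linarith [le_abs_self ρ]
  have hχ1 : ∀ t, ∀ z ∈ closedBall (0 : R3) ρ, χ (t, z) = 1 := fun t z hz =>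
    β.one_of_mem_closedBall (ball_subset_closedBall (hlt z hz))
  have hχt : ∀ t z, dirD eT χ (t, z) = 0 := fun t z => by
    rw [← (hasDerivAt_time hχ t z).deriv]
    simp [hχdef]
  have hχx : ∀ i t, ∀ z ∈ closedBall (0 : R3) ρ, dirD (eX i) χ (t, z) = 0 := fun i t z hz => by
    rw [← fderiv_space hχ]
    have : (fun y => χ (t, y)) =ᶠ[nhds z] fun _ => 1 := by
      filter_upwards [isOpen_ball.mem_nhds (hlt z hz)] with y hy
      exact β.one_of_mem_closedBall (ball_subset_closedBall hy)
    rw [this.fderiv_eq]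
    simp
  have hWx0 : ∀ i, ∀ t ∈ Set.Icc 0 T, ∀ z ∉ closedBall (0 : R3) ρ, dirD (eX i) W (t, z) = 0 :=
    fun i t ht => dirD_space_eq_zero hW isClosed_closedBall (hW0 t ht) i
  have hE0 : ∀ t ∈ Set.Icc 0 T, ∀ z ∉ closedBall (0 : R3) ρ, energyDensity W (t, z) = 0 :=
    fun t ht z hz => by simp [energyDensity, hWt0 t ht z hz, hWx0 _ t ht z hz]
  have hχmul : ∀ t z x, (z ∉ closedBall (0 : R3) ρ → x = 0) → χ (t, z) * x = x := by
    intro t z x hx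
    by_cases hz : z ∈ closedBall (0 : R3) ρ
    · rw [hχ1 t z hz, one_mul]
    · rw [hx hz, mul_zero]
  have hN : ∀ t ∈ Set.Icc 0 T,
      ∫ z, χ (t, z) * energyDensity W (t, z) = ∫ z, energyDensity W (t, z) := fun t ht =>
    integral_congr_ae (Eventually.of_forall fun z => hχmul t z _ (hE0 t ht z))
  have hU12 : ContDiff ℝ (⊤ : ℕ∞) fun p => χ p * U p ^ 12 := hχ.mul (hU.pow 12)
  set h : ℝ → ℝ := fun t => (∫ z, χ (t, z) * U (t, z) ^ 12) ^ ((1 : ℝ) / 3) with hhdef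
  have hh : Continuous h := by
    refine Continuous.rpow_const ?_ fun _ => Or.inr (by norm_num)
    exact continuous_iff_continuousAt.2 fun t => (hasDerivAt_integral_space hU12 hK
      (t₀ := t) fun s _ z hz => by simp [hχ0 s z hz]).continuousAt
  have hheq : ∀ t ∈ Set.Icc 0 T, h t = (∫ z, |U (t, z)| ^ 12) ^ ((1 : ℝ) / 3) := by
    intro t ht
    simp only [hhdef]
    congr 1
    refine integral_congr_ae (Eventually.of_forall fun z => ?_)
    simp only
    rw [hχmul t z _ fun hz => by simp [hU0 t ht z hz], Even.pow_abs (by decide)]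
  have hder : ∀ t ∈ Set.Icc 0 T, ∃ D ≤ M * S * h t * ∫ z, energyDensity W (t, z),
      HasDerivAt (fun t => ∫ z, χ (t, z) * energyDensity W (t, z)) D t := by
    intro t ht
    refine ⟨_, ?_, hasDerivAt_weighted_energy hχ hW hK fun t _ => hχ0 t⟩
    have cU := (contDiff_slice hU t).continuous
    have cW := contDiff_slice hW t
    have cWt := (contDiff_slice (contDiff_dirD hW eT) t).continuous
    have sU := HasCompactSupport.intro hKρ (hU0 t ht)
    have sW := HasCompactSupport.intro hKρ (hW0 t ht)
    have sWt := HasCompactSupport.intro hKρ (hWt0 t ht)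
    have hq := hS _ _ _ cU sU (cW.of_le (by simp)) sW cWt sWt
    simp only [fderiv_space hW] at hq
    have hint : Integrable fun z => M * (|U (t, z)| ^ 4 * |W (t, z)| * |dirD eT W (t, z)|) := by
      refine Continuous.integrable_of_hasCompactSupport ?_
        (HasCompactSupport.intro hKρ fun z hz => by simp [hWt0 t ht z hz])
      exact continuous_const.mul (((cU.abs.pow 4).mul cW.continuous.abs).mul cWt.abs)
    refine (Real.le_norm_self _).trans ((norm_integral_le_of_norm_le hint
      (Eventually.of_forall fun z => ?_)).trans ?_)
    · have hz : ∑ i, dirD (eX i) χ (t, z) * dirD (eX i) W (t, z) = 0 := by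
        refine Finset.sum_eq_zero fun i _ => ?_
        by_cases hz : z ∈ closedBall (0 : R3) ρ
        · rw [hχx i t z hz, zero_mul]
        · rw [hWx0 i t ht z hz, mul_zero]
      rw [hχt, hz, hχmul t z _ fun hz => by rw [hWt0 t ht z hz, zero_mul]]
      rw [zero_mul, zero_add, mul_zero, sub_zero, Real.norm_eq_abs, abs_mul]
      calc |dirD eT W (t, z)| * |box W (t, z)|
          ≤ |dirD eT W (t, z)| * (M * (|U (t, z)| ^ 4 * |W (t, z)|)) :=
            mul_le_mul_of_nonneg_left (hbox _) (abs_nonneg _)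
        _ = _ := by ring
    · rw [integral_const_mul, hheq t ht, mul_assoc M S, mul_assoc M]
      exact mul_le_mul_of_nonneg_left hq hM
  set H : ℝ → ℝ := fun t => ∫ τ in (0 : ℝ)..t, h τ
  have hH : ∀ t, HasDerivAt H (h t) t := fun t => (hh.integral_hasStrictDerivAt 0 t).hasDerivAt
  have hG : ∀ t ∈ Set.Icc 0 T, ∃ D ≤ 0, HasDerivAt (fun t =>
      (∫ z, χ (t, z) * energyDensity W (t, z)) * Real.exp (-(M * S * H t))) D t := by
    intro t ht
    obtain ⟨D, hD, hd⟩ := hder t ht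
    refine ⟨_, ?_, hd.mul ((hH t).const_mul (M * S)).neg.exp⟩
    simp only [hN t ht, Pi.neg_apply]
    have := mul_le_mul_of_nonneg_right hD (Real.exp_pos (-(M * S * H t))).le
    linarith
  have hanti := antitoneOn_of_deriv_nonpos (convex_Icc 0 T)
    (f := fun t => (∫ z, χ (t, z) * energyDensity W (t, z)) * Real.exp (-(M * S * H t)))
    (fun s hs => by
      obtain ⟨D, -, h⟩ := hG s hs
      exact h.continuousAt.continuousWithinAt)
    (fun s hs => by
      obtain ⟨D, -, h⟩ := hG s (interior_subset hs)
      exact h.differentiableAt.differentiableWithinAt)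
    (fun s hs => by
      obtain ⟨D, hD, h⟩ := hG s (interior_subset hs)
      rwa [h.deriv])
  have hfin := hanti ⟨le_rfl, hT⟩ ⟨hT, le_rfl⟩ hT
  have hHT : H T = ∫ τ in (0 : ℝ)..T, (∫ z, |U (τ, z)| ^ 12) ^ ((1 : ℝ) / 3) :=
    intervalIntegral.integral_congr fun τ hτ => hheq τ (by rwa [Set.uIcc_of_le hT] at hτ)
  have hH0 : H 0 = 0 := intervalIntegral.integral_same
  simp only [hN 0 ⟨le_rfl, hT⟩, hN T ⟨hT, le_rfl⟩, hH0, mul_zero, neg_zero, Real.exp_zero,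
    mul_one, Real.exp_neg] at hfin
  rw [← hHT]
  rwa [mul_inv_le_iff₀ (Real.exp_pos _)] at hfin

namespace NiceF

variable {f : ℝ → ℝ}

lemma contDiff (hf : NiceF f) : ContDiff ℝ (⊤ : ℕ∞) f := by
  obtain ⟨⟨f₀, hf₀, hff, -⟩, -⟩ := hf
  rw [show f = fun v => v * f₀ (v ^ 2) from funext hff]
  exact contDiff_id.mul (hf₀.comp (contDiff_id.pow 2))

/-- A nice nonlinearity has a smooth nonnegative potential. -/
lemma exists_potential (hf : NiceF f) :
    ∃ F : ℝ → ℝ, ContDiff ℝ (⊤ : ℕ∞) F ∧ deriv F = f ∧ (∀ v, 0 ≤ F v) ∧ F 0 = 0 := by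
  have hc := hf.contDiff
  obtain ⟨⟨f₀, -, hff, hpos⟩, -⟩ := hf
  have hd : ∀ v, HasDerivAt (fun v => ∫ w in (0 : ℝ)..v, f w) (f v) v := fun v =>
    (hc.continuous.integral_hasStrictDerivAt 0 v).hasDerivAt
  have hderiv : deriv (fun v => ∫ w in (0 : ℝ)..v, f w) = f := funext fun v => (hd v).deriv
  refine ⟨_, contDiff_infty_iff_deriv.2 ⟨fun v => (hd v).differentiableAt, ?_⟩, hderiv, ?_,
    intervalIntegral.integral_same⟩
  · rwa [hderiv]
  · intro v
    rcases le_total 0 v with hv | hv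
    · exact intervalIntegral.integral_nonneg hv fun w hw => by
        rw [hff]
        exact mul_nonneg hw.1 (hpos _ (sq_nonneg w))
    · rw [intervalIntegral.integral_symm, ← intervalIntegral.integral_neg]
      exact intervalIntegral.integral_nonneg hv fun w hw => by
        rw [hff, ← neg_mul]
        exact mul_nonneg (neg_nonneg.2 hw.2) (hpos _ (sq_nonneg w))

lemma exists_growth_bound (hf : NiceF f) :
    ∃ M : ℝ, 0 < M ∧ (∀ v, |f v| ≤ M * (|v| ^ 4 * |v|)) ∧ ∀ v, |deriv f v| ≤ M * |v| ^ 4 := by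
  have hc := hf.contDiff
  obtain ⟨-, ⟨_, c₄, -, hc₄, h4⟩, ⟨_, c₂, -, hc₂, h2⟩, -⟩ := hf
  refine ⟨c₂ + c₄ * c₂, by positivity, fun v => ?_, ?_⟩
  · have : 0 ≤ c₄ * c₂ * |v| ^ 5 := by positivity
    nlinarith [(h2 v).2]
  · have hcl : IsClosed {v : ℝ | |deriv f v| ≤ (c₂ + c₄ * c₂) * |v| ^ 4} :=
      isClosed_le (hc.continuous_deriv (by simp)).abs (by fun_prop)
    have hsub : ({0}ᶜ : Set ℝ) ⊆ {v : ℝ | |deriv f v| ≤ (c₂ + c₄ * c₂) * |v| ^ 4} := by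
      intro v hv
      have hv' : 0 < |v| := abs_pos.2 hv
      refine le_of_mul_le_mul_left ?_ hv'
      have h := (h4 v).2
      rw [abs_mul] at h
      have h' := mul_le_mul_of_nonneg_left (h2 v).2 hc₄.le
      have : 0 ≤ c₂ * |v| ^ 5 := by positivity
      linarith
    intro v
    have := closure_minimal hsub hcl
    rw [(dense_compl_singleton (0 : ℝ)).closure_eq] at this
    exact this (Set.mem_univ v)

end NiceF

lemma box_dirD {U : ℝ × R3 → ℝ} (hU : ContDiff ℝ (⊤ : ℕ∞) U) (v p : ℝ × R3) :
    box (dirD v U) p = dirD v (box U) p := by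
  have hc : ∀ a, dirD a (dirD a (dirD v U)) = dirD v (dirD a (dirD a U)) := fun a => by
    rw [dirD_comm hU a v, dirD_comm (contDiff_dirD hU a) a v]
  have hd : ∀ a, HasFDerivAt (dirD a (dirD a U)) (fderiv ℝ (dirD a (dirD a U)) p) p := fun a =>
    ((contDiff_dirD (contDiff_dirD hU a) a).differentiable (by simp) p).hasFDerivAt
  have h : fderiv ℝ (box U) p = _ :=
    ((hd eT).sub (HasFDerivAt.fun_sum (u := Finset.univ) fun i _ => hd (eX i))).fderiv
  rw [dirD, h]
  simp only [box, hc]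
  simp [dirD]

section solution

variable {u : ℝ → R3 → ℝ}

lemma dt_eq_dirD (hu : ContDiff ℝ (⊤ : ℕ∞) fun p : ℝ × R3 => u p.1 p.2) (t : ℝ) (z : R3) :
    dt u t z = dirD eT (fun p => u p.1 p.2) (t, z) :=
  (hasDerivAt_time hu t z).deriv

lemma fderiv_eq_dirD (hu : ContDiff ℝ (⊤ : ℕ∞) fun p : ℝ × R3 => u p.1 p.2) (t : ℝ) (z : R3)
    (i : Fin 3) :
    fderiv ℝ (u t) z (EuclideanSpace.single i 1) = dirD (eX i) (fun p => u p.1 p.2) (t, z) :=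
  fderiv_space hu t z i

lemma dt2_sub_lap_eq_box (hu : ContDiff ℝ (⊤ : ℕ∞) fun p : ℝ × R3 => u p.1 p.2) (t : ℝ)
    (z : R3) : dt2 u t z - lap (u t) z = box (fun p => u p.1 p.2) (t, z) := by
  simp only [dt2, lap, box, dt_eq_dirD hu, fderiv_eq_dirD hu,
    fderiv_space (contDiff_dirD hu (eX _)), (hasDerivAt_time (contDiff_dirD hu eT) t z).deriv]

lemma energy2_eq (hu : ContDiff ℝ (⊤ : ℕ∞) fun p : ℝ × R3 => u p.1 p.2) (t : ℝ) :
    energy2 u t = √((∫ z, energyDensity (fun p => u p.1 p.2) (t, z)) +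
      ∑ j, ∫ z, energyDensity (dirD (eX j) fun p => u p.1 p.2) (t, z)) := by
  simp only [energy2, energyDensity, integral_const_mul, norm_gradient_sq, dt_eq_dirD hu,
    fderiv_eq_dirD hu, fderiv_space (contDiff_dirD hu (eX _)), ← Finset.mul_sum,
    fderiv_space (contDiff_dirD hu eT), dirD_comm hu eT (eX _)]

/-- Solutions with compactly supported data are supported in a fixed ball on bounded time
intervals. -/
lemma exists_support_radius {F : ℝ → ℝ} (hF : ContDiff ℝ (⊤ : ℕ∞) F) (hF0 : ∀ v, 0 ≤ F v)
    (hF00 : F 0 = 0) {U : ℝ × R3 → ℝ} (hU : ContDiff ℝ (⊤ : ℕ∞) U)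
    (hbox : ∀ p, box U p = -deriv F (U p)) (h0 : HasCompactSupport fun z => U (0, z))
    (h1 : HasCompactSupport fun z => dirD eT U (0, z)) (T : ℝ) :
    ∃ ρ, ∀ t ∈ Set.Icc 0 T, ∀ z ∉ closedBall (0 : R3) ρ,
      U (t, z) = 0 ∧ dirD eT U (t, z) = 0 := by
  obtain ⟨R, hR⟩ := (h0.isCompact.union h1.isCompact).isBounded.subset_closedBall (0 : R3)
  refine ⟨R + (T + 1), fun t ht z hz => ?_⟩
  have hball : ∀ y ∈ ball z (T + 1),
      y ∉ tsupport (fun z => U (0, z)) ∪ tsupport (fun z => dirD eT U (0, z)) := by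
    intro y hy hmem
    have h2 := hR hmem
    rw [mem_closedBall] at hz h2
    rw [mem_ball, dist_comm] at hy
    linarith [dist_triangle z y 0]
  exact finite_speed hF hF0 hF00 hU hbox
    (fun y hy => image_eq_zero_of_notMem_tsupport (f := fun z => U (0, z)) fun h =>
      hball y hy (Or.inl h))
    (fun y hy => image_eq_zero_of_notMem_tsupport (f := fun z => dirD eT U (0, z)) fun h =>
      hball y hy (Or.inr h))
    ht.1 (by linarith [ht.2] : t < T + 1)

end solution

/-- Higher-order energy estimate: E₂(t) ≤ E₂(0)·exp(C ∫₀ᵗ ‖u(τ)‖_{L¹²}⁴ dτ), with C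
depending only on the nonlinearity f. -/
theorem second_order_energy_gronwall_estimate
    (f : ℝ → ℝ) (hf : NiceF f) :
    ∃ C : ℝ, 0 < C ∧
      ∀ (u : ℝ → R3 → ℝ), ContDiff ℝ (⊤ : ℕ∞) (fun p : ℝ × R3 => u p.1 p.2) →
        (∀ t z, dt2 u t z - lap (u t) z + f (u t z) = 0) →
        ContDiff ℝ (⊤ : ℕ∞) (u 0) → HasCompactSupport (u 0) →
        ContDiff ℝ (⊤ : ℕ∞) (fun z => dt u 0 z) → HasCompactSupport (fun z => dt u 0 z) →
        (∀ t : ℝ, HasCompactSupport (u t)) →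
        ∀ t : ℝ, 0 ≤ t →
          energy2 u t ≤ energy2 u 0 * Real.exp (C * ∫ τ in (0:ℝ)..t,
            (∫ z : R3, |u τ z| ^ 12) ^ ((1 : ℝ) / 3)) := by
  obtain ⟨S, hS, hquartic⟩ := exists_quartic_energy_bound
  obtain ⟨M, hM, hfM, hfM'⟩ := hf.exists_growth_bound
  obtain ⟨F, hF, hFf, hF0, hF00⟩ := hf.exists_potential
  refine ⟨M * S / 2, by positivity, fun u hu heq _ h0 _ h1 _ t ht => ?_⟩
  set U : ℝ × R3 → ℝ := fun p => u p.1 p.2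
  have hbox : box U = fun p => -f (U p) := funext fun p => by
    linarith [heq p.1 p.2, dt2_sub_lap_eq_box hu p.1 p.2]
  simp only [dt_eq_dirD hu] at h1
  obtain ⟨ρ, hρ⟩ := exists_support_radius hF hF0 hF00 hu (by simp [hbox, hFf]) h0 h1 t
  have hx0 := fun j s hs => dirD_space_eq_zero hu isClosed_closedBall
    (fun z hz => (hρ s hs z hz).1) j
  have hE0 := integral_energyDensity_le hM.le hquartic hu hu ht (fun s hs z hz => (hρ s hs z hz).1)
    (fun s hs z hz => (hρ s hs z hz).1) (fun s hs z hz => (hρ s hs z hz).2)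
    (fun p => by rw [hbox, abs_neg]; exact hfM _)
  have hEj := fun j => integral_energyDensity_le hM.le hquartic hu (contDiff_dirD hu (eX j)) ht
    (fun s hs z hz => (hρ s hs z hz).1) (hx0 j)
    (fun s hs => by
      rw [dirD_comm hu]
      exact dirD_space_eq_zero (contDiff_dirD hu eT) isClosed_closedBall
        (fun z hz => (hρ s hs z hz).2) j)
    (fun p => by
      have hneg : Differentiable ℝ fun v => -f v := (hf.contDiff.differentiable (by simp)).neg
      rw [box_dirD hu, hbox, dirD_comp hneg hu, abs_mul, ← mul_assoc, deriv.fun_neg,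
        abs_neg]
      exact mul_le_mul_of_nonneg_right (hfM' _) (abs_nonneg _))
  rw [energy2_eq hu, energy2_eq hu]
  have hexp : ∀ x : ℝ, Real.exp (M * S / 2 * x) = √(Real.exp (M * S * x)) := fun x => by
    rw [← Real.exp_half]
    congr 1
    ring
  rw [hexp, ← Real.sqrt_mul' _ (Real.exp_pos _).le]
  refine Real.sqrt_le_sqrt ?_
  rw [add_mul, Finset.sum_mul]
  exact add_le_add hE0 (Finset.sum_le_sum fun j _ => hEj j)
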